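/- Let N ∈ ℕ be such that k_N (the largest k ≤ N with μ_N − r_N ≥ 2 μ_{k}) exists, and assume σ_N < ∞, σ_{k_N} < ∞ and ρ_N < ∞. Let v : ℕ × ℕ → ℂ satisfy |v_{jk}| ≤ ω_j ω_k for all j, k, and let f ∈ ℓ²(ℕ, ℂ) with coordinates f_j. Then Σ_{n ≥ N} | Σ_{k ≠ n} (v_{nk}/(μ_n − μ_k)) f_n \overline{f_k} + Σ_{j ≠ n} (v_{jn}/(μ_n − μ_j)) f_j \overline{f_n} | ≤ 2 ( σ_N · max{2 ρ_N, σ_{k_N}} )^{1/2} · ‖f‖², where ‖f‖² = Σ_j |f_j|². -/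

import Mathlib

open scoped ENNReal ComplexConjugate

/-- `σ_N = sup_{n ≥ N} ( Σ_{j ≠ n} ω_j²/|μ_n − μ_j| + ω_n²/r_n )`, valued in `[0,∞]`. -/
noncomputable def sigmaN (μ ω r : ℕ → ℝ) (N : ℕ) : ℝ≥0∞ :=
  ⨆ n, ⨆ (_ : N ≤ n),
    ((∑' j : ℕ, if 1 ≤ j ∧ j ≠ n then ENNReal.ofReal (ω j ^ 2 / |μ n - μ j|) else 0)
      + ENNReal.ofReal (ω n ^ 2 / r n))

/-- `ρ_N = Σ_{n ≥ N} ω_n²/μ_n`, valued in `[0,∞]`. -/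
noncomputable def rhoN (μ ω : ℕ → ℝ) (N : ℕ) : ℝ≥0∞ :=
  ∑' n : ℕ, if N ≤ n then ENNReal.ofReal (ω n ^ 2 / μ n) else 0

/-- `k_N`, the largest `k ≤ N` (with `k ≥ 1`) such that `μ_N − r_N ≥ 2 μ_k`. -/
noncomputable def kN (μ r : ℕ → ℝ) (N : ℕ) : ℕ :=
  sSup {k : ℕ | 1 ≤ k ∧ k ≤ N ∧ 2 * μ k ≤ μ N - r N}

/-- Cauchy–Schwarz inequality for sums of extended nonnegative reals. -/
lemma ENNReal.tsum_mul_le_sqrt_mul_sqrt {ι : Type*} [Countable ι] (a b : ι → ℝ≥0∞) :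
    ∑' i, a i * b i ≤ (∑' i, a i ^ 2) ^ (1 / 2 : ℝ) * (∑' i, b i ^ 2) ^ (1 / 2 : ℝ) := by
  let _ : MeasurableSpace ι := ⊤
  have h := ENNReal.lintegral_mul_le_Lp_mul_Lq (MeasureTheory.Measure.count (α := ι))
    Real.HolderConjugate.two_two (f := a) (g := b)
    (measurable_of_countable a).aemeasurable (measurable_of_countable b).aemeasurable
  simpa [MeasureTheory.lintegral_count] using h

/-- The norm of a (possibly divergent) series is at most the sum of the norms. -/
lemma ofReal_norm_tsum_le {ι : Type*} (u : ι → ℂ) :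
    ENNReal.ofReal ‖∑' i, u i‖ ≤ ∑' i, ENNReal.ofReal ‖u i‖ := by
  simpa only [ofReal_norm] using enorm_tsum_le_tsum_enorm (f := u)

/-- A sequence increasing from index `1` on is strictly monotone there. -/
lemma lt_of_lt_succ_from_one {μ : ℕ → ℝ} (hμ : ∀ n, 1 ≤ n → μ n < μ (n + 1)) {m n : ℕ}
    (hm : 1 ≤ m) (hmn : m < n) : μ m < μ n := by
  induction n, hmn using Nat.le_induction with
  | base => exact hμ m hm
  | succ n hn ih => exact ih.trans (hμ n (by omega))

lemma le_of_lt_succ_from_one {μ : ℕ → ℝ} (hμ : ∀ n, 1 ≤ n → μ n < μ (n + 1)) {m n : ℕ}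
    (hm : 1 ≤ m) (hmn : m ≤ n) : μ m ≤ μ n := by
  rcases hmn.eq_or_lt with rfl | h
  · exact le_rfl
  · exact (lt_of_lt_succ_from_one hμ hm h).le

lemma tsum_le_sigmaN (μ ω r : ℕ → ℝ) {N n : ℕ} (h : N ≤ n) :
    (∑' j : ℕ, if 1 ≤ j ∧ j ≠ n then ENNReal.ofReal (ω j ^ 2 / |μ n - μ j|) else 0)
      ≤ sigmaN μ ω r N :=
  le_self_add.trans (le_iSup₂_of_le n h le_rfl)

/-- Bound for the column sums of the kernel `ω_n² / |μ_n - μ_k|`, `n ≥ N`. -/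
lemma tsum_column_le (μ ω r : ℕ → ℝ) (hμ1 : 0 < μ 1)
    (hμ : ∀ n, 1 ≤ n → μ n < μ (n + 1)) {N : ℕ} (hr : 0 ≤ r N)
    (hkex : {k : ℕ | 1 ≤ k ∧ k ≤ N ∧ 2 * μ k ≤ μ N - r N}.Nonempty) {k : ℕ} (hk : 1 ≤ k) :
    (∑' n : ℕ, if N ≤ n ∧ k ≠ n then ENNReal.ofReal (ω n ^ 2 / |μ n - μ k|) else 0)
      ≤ max (2 * rhoN μ ω N) (sigmaN μ ω r (kN μ r N)) := by
  obtain ⟨hK1, hKN, hK⟩ : kN μ r N ∈ {k : ℕ | 1 ≤ k ∧ k ≤ N ∧ 2 * μ k ≤ μ N - r N} :=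
    Nat.sSup_mem hkex ⟨N, fun k hk => hk.2.1⟩
  have hN : 1 ≤ N := hK1.trans hKN
  rcases le_total (kN μ r N) k with h | h
  · refine le_max_of_le_right (le_trans ?_ (tsum_le_sigmaN μ ω r h))
    refine ENNReal.tsum_le_tsum fun n => ?_
    split_ifs with h1 h2
    · rw [abs_sub_comm]
    · exact absurd ⟨hN.trans h1.1, h1.2.symm⟩ h2
    · exact zero_le
    · exact le_rfl
  · refine le_max_of_le_left ?_
    rw [rhoN, ← ENNReal.tsum_mul_left]
    refine ENNReal.tsum_le_tsum fun n => ?_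
    split_ifs with h1 h2
    · rw [← ENNReal.ofReal_ofNat, ← ENNReal.ofReal_mul (by norm_num)]
      apply ENNReal.ofReal_le_ofReal
      have hkK : μ k ≤ μ (kN μ r N) := le_of_lt_succ_from_one hμ hk h
      have hNn : μ N ≤ μ n := le_of_lt_succ_from_one hμ hN h1.1
      have hpos : 0 < μ n := hμ1.trans_le (le_of_lt_succ_from_one hμ le_rfl (hN.trans h1.1))
      calc ω n ^ 2 / |μ n - μ k| ≤ ω n ^ 2 / (μ n / 2) :=
            div_le_div_of_nonneg_left (sq_nonneg _) (by linarith)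
              (le_trans (by linarith) (le_abs_self _))
        _ = 2 * (ω n ^ 2 / μ n) := by field_simp
    · exact absurd h1.1 h2
    · exact zero_le
    · exact zero_le

/-- Schur-type bound for the bilinear form with kernel `ω_n ω_k / |μ_n - μ_k|`. -/
lemma tsum_kernel_le (μ ω r : ℕ → ℝ) (hμ1 : 0 < μ 1)
    (hμ : ∀ n, 1 ≤ n → μ n < μ (n + 1)) (hω : ∀ j, 0 ≤ ω j) {N : ℕ} (hr : 0 ≤ r N)
    (hkex : {k : ℕ | 1 ≤ k ∧ k ≤ N ∧ 2 * μ k ≤ μ N - r N}.Nonempty) (f : ℕ → ℂ) :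
    (∑' n : ℕ, ∑' k : ℕ, if N ≤ n ∧ 1 ≤ k ∧ k ≠ n then
        ENNReal.ofReal (ω n * ω k / |μ n - μ k| * (‖f n‖ * ‖f k‖)) else 0)
      ≤ (sigmaN μ ω r N * max (2 * rhoN μ ω N) (sigmaN μ ω r (kN μ r N))) ^ (1 / 2 : ℝ)
        * ∑' j : ℕ, if 1 ≤ j then ENNReal.ofReal (‖f j‖ ^ 2) else 0 := by
  have hN : 1 ≤ N := by
    obtain ⟨k, h1, h2, -⟩ := hkex
    exact h1.trans h2
  set S := ∑' j : ℕ, if 1 ≤ j then ENNReal.ofReal (‖f j‖ ^ 2) else 0 with hS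
  set M := max (2 * rhoN μ ω N) (sigmaN μ ω r (kN μ r N)) with hM
  let a : ℕ × ℕ → ℝ≥0∞ := fun p => if N ≤ p.1 ∧ 1 ≤ p.2 ∧ p.2 ≠ p.1 then
    ENNReal.ofReal (‖f p.1‖ * (ω p.2 / √|μ p.1 - μ p.2|)) else 0
  let b : ℕ × ℕ → ℝ≥0∞ := fun p => if N ≤ p.1 ∧ 1 ≤ p.2 ∧ p.2 ≠ p.1 then
    ENNReal.ofReal (‖f p.2‖ * (ω p.1 / √|μ p.1 - μ p.2|)) else 0
  have hab : (∑' n : ℕ, ∑' k : ℕ, if N ≤ n ∧ 1 ≤ k ∧ k ≠ n then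
      ENNReal.ofReal (ω n * ω k / |μ n - μ k| * (‖f n‖ * ‖f k‖)) else 0)
      = ∑' p, a p * b p := by
    rw [ENNReal.tsum_prod']
    refine tsum_congr fun n => tsum_congr fun k => ?_
    simp only [a, b]
    split_ifs with h
    · rw [← ENNReal.ofReal_mul (mul_nonneg (norm_nonneg _)
        (div_nonneg (hω _) (Real.sqrt_nonneg _)))]
      congr 1
      rw [show ‖f n‖ * (ω k / √|μ n - μ k|) * (‖f k‖ * (ω n / √|μ n - μ k|))
        = ω n * ω k / (√|μ n - μ k| * √|μ n - μ k|) * (‖f n‖ * ‖f k‖) by ring,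
        Real.mul_self_sqrt (abs_nonneg _)]
    · simp
  have hsq : ∀ x y d : ℝ, 0 ≤ x → 0 ≤ y → ENNReal.ofReal (x * (y / √|d|)) ^ 2
      = ENNReal.ofReal (x ^ 2) * ENNReal.ofReal (y ^ 2 / |d|) := fun x y d hx hy => by
    rw [← ENNReal.ofReal_pow (mul_nonneg hx (div_nonneg hy (Real.sqrt_nonneg _))),
      ← ENNReal.ofReal_mul (sq_nonneg _), mul_pow, div_pow, Real.sq_sqrt (abs_nonneg _)]
  have ha : ∑' p, a p ^ 2 ≤ sigmaN μ ω r N * S := by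
    rw [ENNReal.tsum_prod', hS, ← ENNReal.tsum_mul_left]
    refine ENNReal.tsum_le_tsum fun n => ?_
    by_cases hn : N ≤ n
    · rw [if_pos (hN.trans hn), mul_comm]
      refine le_trans ?_ (mul_le_mul_right (tsum_le_sigmaN μ ω r hn) _)
      rw [← ENNReal.tsum_mul_left]
      refine ENNReal.tsum_le_tsum fun k => ?_
      simp only [a, hn, true_and]
      split_ifs with h
      · exact (hsq _ _ _ (norm_nonneg _) (hω _)).le
      · simp
    · simp [a, hn]
  have hb : ∑' p, b p ^ 2 ≤ M * S := by
    rw [ENNReal.tsum_prod', ENNReal.tsum_comm, hS, ← ENNReal.tsum_mul_left]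
    refine ENNReal.tsum_le_tsum fun k => ?_
    by_cases hk : 1 ≤ k
    · rw [if_pos hk, mul_comm]
      refine le_trans ?_ (mul_le_mul_right (tsum_column_le μ ω r hμ1 hμ hr hkex hk) _)
      rw [← ENNReal.tsum_mul_left]
      refine ENNReal.tsum_le_tsum fun n => ?_
      simp only [b, hk, true_and]
      split_ifs with h
      · exact (hsq _ _ _ (norm_nonneg _) (hω _)).le
      · simp
    · simp [b, hk]
  rw [hab]
  calc ∑' p, a p * b p
      ≤ (∑' p, a p ^ 2) ^ (1 / 2 : ℝ) * (∑' p, b p ^ 2) ^ (1 / 2 : ℝ) :=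
        ENNReal.tsum_mul_le_sqrt_mul_sqrt a b
    _ ≤ (sigmaN μ ω r N * S) ^ (1 / 2 : ℝ) * (M * S) ^ (1 / 2 : ℝ) := by gcongr
    _ = (sigmaN μ ω r N * M) ^ (1 / 2 : ℝ) * S := by
        rw [← ENNReal.mul_rpow_of_nonneg _ _ (by norm_num), mul_mul_mul_comm,
          ENNReal.mul_rpow_of_nonneg _ _ (by norm_num), ← sq S, ← ENNReal.rpow_natCast_mul]
        norm_num

theorem statement6 (μ ω r : ℕ → ℝ)
    (hμ1 : 0 < μ 1)
    (hμmono : ∀ n, 1 ≤ n → μ n < μ (n + 1))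
    (hμtop : Filter.Tendsto μ Filter.atTop Filter.atTop)
    (hr1 : r 1 = (μ 2 - μ 1) / 2)
    (hrn : ∀ n, 2 ≤ n → r n = min (μ n - μ (n - 1)) (μ (n + 1) - μ n) / 2)
    (hω : ∀ j, 0 ≤ ω j)
    (N : ℕ)
    (hkex : {k : ℕ | 1 ≤ k ∧ k ≤ N ∧ 2 * μ k ≤ μ N - r N}.Nonempty)
    (hσN : sigmaN μ ω r N < ⊤)
    (hσk : sigmaN μ ω r (kN μ r N) < ⊤)
    (hρ : rhoN μ ω N < ⊤)
    (v : ℕ → ℕ → ℂ)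
    (hv : ∀ j k, 1 ≤ j → 1 ≤ k → ‖v j k‖ ≤ ω j * ω k)
    (f : ℕ → ℂ)
    (hf : Summable fun j => ‖f j‖ ^ 2) :
    (∑' n : ℕ, if N ≤ n then
        ENNReal.ofReal (‖
          ((∑' k : ℕ, if 1 ≤ k ∧ k ≠ n then
              v n k / ((μ n : ℂ) - (μ k : ℂ)) * f n * conj (f k) else 0)
           + ∑' j : ℕ, if 1 ≤ j ∧ j ≠ n then
              v j n / ((μ n : ℂ) - (μ j : ℂ)) * f j * conj (f n) else 0 : ℂ)‖)
      else 0)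
      ≤ 2 * (sigmaN μ ω r N * max (2 * rhoN μ ω N) (sigmaN μ ω r (kN μ r N))) ^ (1/2 : ℝ)
        * (∑' j : ℕ, if 1 ≤ j then ENNReal.ofReal (‖f j‖ ^ 2) else 0) := by
  have hN : 1 ≤ N := by
    obtain ⟨k, h1, h2, -⟩ := hkex
    exact h1.trans h2
  have hr : 0 ≤ r N := by
    rcases hN.eq_or_lt with rfl | h
    · rw [hr1]
      linarith [hμmono 1 le_rfl]
    · rw [hrn N h]
      have h1 := lt_of_lt_succ_from_one hμmono (show 1 ≤ N - 1 by omega) (show N - 1 < N by omega)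
      exact div_nonneg (le_min (by linarith) (by linarith [hμmono N hN])) (by norm_num)
  rw [mul_assoc]
  refine le_trans ?_ (mul_le_mul_right (tsum_kernel_le μ ω r hμ1 hμmono hω hr hkex f) 2)
  rw [← ENNReal.tsum_mul_left]
  refine ENNReal.tsum_le_tsum fun n => ?_
  split_ifs with hn
  swap
  · exact zero_le
  have hn1 : 1 ≤ n := hN.trans hn
  refine (ENNReal.ofReal_le_ofReal (norm_add_le _ _)).trans ?_
  rw [ENNReal.ofReal_add (norm_nonneg _) (norm_nonneg _), two_mul]
  refine add_le_add ((ofReal_norm_tsum_le _).trans (ENNReal.tsum_le_tsum fun k => ?_))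
    ((ofReal_norm_tsum_le _).trans (ENNReal.tsum_le_tsum fun k => ?_))
  all_goals
    simp only [hn, true_and]
    split_ifs with h
    swap
    · simp
    apply ENNReal.ofReal_le_ofReal
    rw [norm_mul, norm_mul, norm_div, RCLike.norm_conj, ← Complex.ofReal_sub, Complex.norm_real,
      Real.norm_eq_abs]
  · rw [mul_assoc]
    gcongr
    exact hv n k hn1 h.1
  · rw [mul_assoc, mul_comm ‖f k‖, mul_comm (ω n)]
    gcongr
    exact hv k n h.1 hn1
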